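/- Let B be the normal closure in G of the generator b. For all x, y ∈ B there exists h ∈ G fixing the one-letter words [0] and [1] whose sections satisfy h₀ = x and h₁ = y. -/

import Mathlib

namespace Grig

def aFun : List Bool → List Bool
  | [] => []
  | x :: v => (!x) :: v

mutual
  def bFun : List Bool → List Bool
    | [] => []
    | false :: v => false :: aFun v
    | true :: v => true :: cFun v
  def cFun : List Bool → List Bool
    | [] => []
    | false :: v => false :: aFun v
    | true :: v => true :: dFun v
  def dFun : List Bool → List Bool
    | [] => []
    | false :: v => false :: v
    | true :: v => true :: bFun v
end

theorem aFun_invol : Function.Involutive aFun := by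
  intro v; cases v <;> simp [aFun]

theorem bcd_invol : ∀ v, bFun (bFun v) = v ∧ cFun (cFun v) = v ∧ dFun (dFun v) = v := by
  intro v
  induction v with
  | nil => simp [bFun, cFun, dFun]
  | cons x v ih =>
    cases x <;> simp [bFun, cFun, dFun, aFun_invol v, ih.1, ih.2.1, ih.2.2]

/-- The automorphism `a` of the binary tree. -/
def a : Equiv.Perm (List Bool) := Function.Involutive.toPerm aFun aFun_invol

def b : Equiv.Perm (List Bool) := Function.Involutive.toPerm bFun (fun v => (bcd_invol v).1)

def c : Equiv.Perm (List Bool) := Function.Involutive.toPerm cFun (fun v => (bcd_invol v).2.1)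

def d : Equiv.Perm (List Bool) := Function.Involutive.toPerm dFun (fun v => (bcd_invol v).2.2)

/-- The Grigorchuk group, as the subgroup generated by `a, b, c, d` inside the
permutation group of the vertex set of the binary tree. -/
def grigG : Subgroup (Equiv.Perm (List Bool)) := Subgroup.closure {a, b, c, d}

end Grig

namespace Grig

/-- The normal closure of `b` in the Grigorchuk group: the subgroup generated by all
conjugates `g⁻¹ · b · g` with `g ∈ G`. -/
def Bcl : Subgroup (Equiv.Perm (List Bool)) :=
  Subgroup.closure {p | ∃ g ∈ grigG, p = g⁻¹ * b * g}

end Grig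

namespace Grig

/-- `h` has sections `p` and `q`. -/
def Sec (h p q : Equiv.Perm (List Bool)) : Prop :=
  (∀ w, h (false :: w) = false :: p w) ∧ (∀ w, h (true :: w) = true :: q w)

theorem Sec.mul {h p q h' p' q' : Equiv.Perm (List Bool)} (H : Sec h p q) (H' : Sec h' p' q') :
    Sec (h * h') (p * p') (q * q') := by
  constructor <;> intro w <;> simp [Equiv.Perm.mul_apply, H.1, H.2, H'.1, H'.2]

theorem Sec.inv {h p q : Equiv.Perm (List Bool)} (H : Sec h p q) : Sec h⁻¹ p⁻¹ q⁻¹ := by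
  constructor <;> intro w <;> rw [Equiv.Perm.inv_eq_iff_eq]
  · rw [H.1]; simp
  · rw [H.2]; simp

theorem Sec.one : Sec 1 1 1 := ⟨fun _ => rfl, fun _ => rfl⟩

theorem a_app (w : List Bool) : a w = aFun w := rfl
theorem b_app (w : List Bool) : b w = bFun w := rfl
theorem c_app (w : List Bool) : c w = cFun w := rfl
theorem d_app (w : List Bool) : d w = dFun w := rfl

theorem sec_b : Sec b a c := by
  constructor <;> intro w <;> simp [a_app, b_app, c_app, bFun]

theorem sec_c : Sec c a d := by
  constructor <;> intro w <;> simp [a_app, d_app, c_app, cFun]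

theorem sec_d : Sec d 1 b := by
  constructor <;> intro w <;> simp [b_app, d_app, dFun]

theorem Sec.conj {h p q : Equiv.Perm (List Bool)} (H : Sec h p q) : Sec (a * h * a) q p := by
  have e : ∀ x w, a (x :: w) = (!x) :: w := fun x w => by simp [a, aFun]
  constructor <;> intro w <;> simp [Equiv.Perm.mul_apply, e, H.1, H.2]

theorem a_mem : a ∈ grigG := Subgroup.subset_closure (by simp)
theorem b_mem : b ∈ grigG := Subgroup.subset_closure (by simp)
theorem c_mem : c ∈ grigG := Subgroup.subset_closure (by simp)
theorem d_mem : d ∈ grigG := Subgroup.subset_closure (by simp)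

theorem conj_mem {h : Equiv.Perm (List Bool)} (H : h ∈ grigG) : a * h * a ∈ grigG :=
  mul_mem (mul_mem a_mem H) a_mem

theorem proj {g : Equiv.Perm (List Bool)} (hg : g ∈ grigG) :
    ∃ h ∈ grigG, ∃ p, Sec h p g := by
  unfold grigG at hg
  induction hg using Subgroup.closure_induction with
  | mem x hx =>
    rcases hx with rfl | rfl | rfl | rfl
    · exact ⟨_, conj_mem b_mem, _, sec_b.conj⟩
    · exact ⟨_, d_mem, _, sec_d⟩
    · exact ⟨_, b_mem, _, sec_b⟩
    · exact ⟨_, c_mem, _, sec_c⟩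
  | one => exact ⟨1, one_mem _, 1, Sec.one⟩
  | mul x y _ _ h1 h2 =>
    obtain ⟨h, hh, p, H⟩ := h1
    obtain ⟨h', hh', p', H'⟩ := h2
    exact ⟨_, mul_mem hh hh', _, H.mul H'⟩
  | inv x _ h1 =>
    obtain ⟨h, hh, p, H⟩ := h1
    exact ⟨_, inv_mem hh, _, H.inv⟩

theorem fix_nil {g : Equiv.Perm (List Bool)} (hg : g ∈ grigG) : g [] = [] := by
  unfold grigG at hg
  induction hg using Subgroup.closure_induction with
  | mem x hx =>
    rcases hx with rfl | rfl | rfl | rfl <;>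
      simp [a_app, b_app, c_app, d_app, aFun, bFun, cFun, dFun]
  | one => rfl
  | mul x y _ _ h1 h2 => simp [Equiv.Perm.mul_apply, h1, h2]
  | inv x _ h1 => rw [Equiv.Perm.inv_eq_iff_eq, h1]

theorem Bcl_le : Bcl ≤ grigG := by
  refine (Subgroup.closure_le _).2 ?_
  rintro _ ⟨g, hg, rfl⟩
  exact mul_mem (mul_mem (inv_mem hg) b_mem) hg

theorem right_lift {y : Equiv.Perm (List Bool)} (hy : y ∈ Bcl) : ∃ h ∈ grigG, Sec h 1 y := by
  unfold Bcl at hy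
  induction hy using Subgroup.closure_induction with
  | mem x hx =>
    obtain ⟨g, hg, rfl⟩ := hx
    obtain ⟨h, hh, p, H⟩ := proj hg
    refine ⟨h⁻¹ * d * h, mul_mem (mul_mem (inv_mem hh) d_mem) hh, ?_⟩
    simpa using (H.inv.mul sec_d).mul H
  | one => exact ⟨1, one_mem _, Sec.one⟩
  | mul x y _ _ h1 h2 =>
    obtain ⟨h, hh, H⟩ := h1
    obtain ⟨h', hh', H'⟩ := h2
    exact ⟨_, mul_mem hh hh', by simpa using H.mul H'⟩
  | inv x _ h1 =>
    obtain ⟨h, hh, H⟩ := h1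
    exact ⟨_, inv_mem hh, by simpa using H.inv⟩

/-- For all `x, y` in the normal closure `B` of `b` in `G`, there is an `h ∈ G` fixing
the one-letter words `[0]` and `[1]` whose sections are `h₀ = x` and `h₁ = y`. -/
theorem Bcl_times_Bcl_le_psi_H (x y : Equiv.Perm (List Bool))
    (hx : x ∈ Bcl) (hy : y ∈ Bcl) :
    ∃ h ∈ grigG, h [false] = [false] ∧ h [true] = [true] ∧
      (∀ w : List Bool, h (false :: w) = false :: x w) ∧
      (∀ w : List Bool, h (true :: w) = true :: y w) := by
  obtain ⟨h, hh, H⟩ := right_lift hx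
  obtain ⟨k, hk, K⟩ := right_lift hy
  have S : Sec (a * h * a * k) x y := by simpa using H.conj.mul K
  refine ⟨_, mul_mem (conj_mem hh) hk, ?_, ?_, S.1, S.2⟩
  · rw [S.1, fix_nil (Bcl_le hx)]
  · rw [S.2, fix_nil (Bcl_le hy)]

end Grig
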